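/- arXiv:1811.00420 — 4 statements merged into one kernel-verified Lean document; each statement's English description precedes it below -/
import Mathlib

section
/- Let S be a system with parts P and Q. Then Q is a part of P (i.e. there exists f : B_P → B_Q with f ∘ r_P = r_Q) if and only if P c-determines Q, i.e. for every a : B_P there exists a unique b : B_Q such that a is compatible with b. -/
/-- `Q` is a part of `P` iff `P` c-determines `Q`: for every `a : B_P`
there is a unique `b : B_Q` compatible with it. -/
theorem part_iff_c_determines {BS BP BQ : Type*}
    (rP : BS → BP) (rQ : BS → BQ)
    (hP : Function.Surjective rP) (hQ : Function.Surjective rQ) :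
    (∃ f : BP → BQ, f ∘ rP = rQ) ↔
      (∀ a : BP, ∃! b : BQ, ∃ s : BS, rP s = a ∧ rQ s = b) := by
  constructor
  · rintro ⟨f, rfl⟩ a
    obtain ⟨s, rfl⟩ := hP a
    refine ⟨f (rP s), ⟨s, rfl, rfl⟩, ?_⟩
    rintro _ ⟨t, ht, rfl⟩
    exact congrArg f ht
  · intro h
    choose f _ hf using h
    exact ⟨f, funext fun s => (hf (rP s) (rQ s) ⟨s, rfl, rfl⟩).symm⟩
end

section
/- Let S be a system with parts P and Q. Define B_{P∪Q} := {(a,b) : B_P × B_Q | c(a,b)} with restriction map r_{P∪Q} s := (r_P s, r_Q s). Then r_{P∪Q} is surjective onto B_{P∪Q} (so P∪Q is a part of S), both P and Q are parts of P∪Q, and P∪Q is the least upper bound: for any part R of S of which both P and Q are parts, P∪Q is a part of R. -/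
universe u

/-- The behavior type of the join `P ∪ Q`: pairs of compatible behaviors. -/
def JoinBehaviors {BS BP BQ : Type u} (rP : BS → BP) (rQ : BS → BQ) : Type u :=
  {ab : BP × BQ // ∃ s : BS, rP s = ab.1 ∧ rQ s = ab.2}

/-- The restriction map of the join part `P ∪ Q`. -/
def rJoin {BS BP BQ : Type u} (rP : BS → BP) (rQ : BS → BQ) :
    BS → JoinBehaviors rP rQ :=
  fun s => ⟨(rP s, rQ s), s, rfl, rfl⟩

/-- `r_{P∪Q}` is surjective, both `P` and `Q` are parts of `P ∪ Q`,
and `P ∪ Q` is the least upper bound of `P` and `Q` among parts of `S`. -/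
theorem join_is_least_upper_bound {BS BP BQ : Type u}
    (rP : BS → BP) (rQ : BS → BQ)
    (hP : Function.Surjective rP) (hQ : Function.Surjective rQ) :
    Function.Surjective (rJoin rP rQ) ∧
    (∃ f : JoinBehaviors rP rQ → BP, f ∘ rJoin rP rQ = rP) ∧
    (∃ g : JoinBehaviors rP rQ → BQ, g ∘ rJoin rP rQ = rQ) ∧
    (∀ (BR : Type u) (rR : BS → BR), Function.Surjective rR →
      (∃ f : BR → BP, f ∘ rR = rP) → (∃ g : BR → BQ, g ∘ rR = rQ) →
      ∃ h : BR → JoinBehaviors rP rQ, h ∘ rR = rJoin rP rQ) := by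
  refine ⟨?_, ⟨fun x => x.1.1, rfl⟩, ⟨fun x => x.1.2, rfl⟩, ?_⟩
  · rintro ⟨_, s, hsP, hsQ⟩
    exact ⟨s, Subtype.ext (Prod.ext hsP hsQ)⟩
  · rintro BR rR hR ⟨f, rfl⟩ ⟨g, rfl⟩
    refine ⟨fun r => ⟨(f r, g r), ?_⟩, rfl⟩
    obtain ⟨s, rfl⟩ := hR r
    exact ⟨s, rfl, rfl⟩
end

section
/- Let S be a system with parts P and Q. Let ~ be the equivalence relation on the disjoint union B_P ⊕ B_Q generated by relating inl a and inr b whenever c(a,b), and let B_{P∩Q} be the quotient (B_P ⊕ B_Q)/~. Then the map B_S → B_{P∩Q} sending s to the class of inl (r_P s) is surjective (so P∩Q is a part of S), it equals the map sending s to the class of inr (r_Q s), P∩Q is a part of both P and Q, and P∩Q is the greatest lower bound: any part R of S that is a part of both P and Q is a part of P∩Q. -/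
universe u

/-- The base relation on `B_P ⊕ B_Q` relating `inl a` and `inr b` whenever
`a` and `b` are compatible. Its equivalence closure defines the meet `P ∩ Q`. -/
def meetRel {BS BP BQ : Type u} (rP : BS → BP) (rQ : BS → BQ) :
    BP ⊕ BQ → BP ⊕ BQ → Prop :=
  fun x y =>
    match x, y with
    | Sum.inl a, Sum.inr b => ∃ s : BS, rP s = a ∧ rQ s = b
    | _, _ => False

/-- The behavior type of the meet `P ∩ Q`: the quotient of `B_P ⊕ B_Q` by the
equivalence relation generated by compatibility. -/
def MeetBehaviors {BS BP BQ : Type u} (rP : BS → BP) (rQ : BS → BQ) : Type u :=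
  Quot (meetRel rP rQ)

/-- The restriction map of the meet part `P ∩ Q`. -/
def rMeet {BS BP BQ : Type u} (rP : BS → BP) (rQ : BS → BQ) :
    BS → MeetBehaviors rP rQ :=
  fun s => Quot.mk (meetRel rP rQ) (Sum.inl (rP s))

theorem mk_inl_eq_mk_inr {BS BP BQ : Type u} (rP : BS → BP) (rQ : BS → BQ) (s : BS) :
    Quot.mk (meetRel rP rQ) (Sum.inl (rP s)) = Quot.mk (meetRel rP rQ) (Sum.inr (rQ s)) :=
  Quot.sound ⟨s, rfl, rfl⟩

/-- the map `s ↦ [inl (r_P s)]` is surjective onto the meet, agrees with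
`s ↦ [inr (r_Q s)]`, `P ∩ Q` is a part of both `P` and `Q`, and `P ∩ Q` is the
greatest lower bound of `P` and `Q` among parts of `S`. -/
theorem meet_is_greatest_lower_bound {BS BP BQ : Type u}
    (rP : BS → BP) (rQ : BS → BQ)
    (hP : Function.Surjective rP) (hQ : Function.Surjective rQ) :
    Function.Surjective (rMeet rP rQ) ∧
    (rMeet rP rQ = fun s => Quot.mk (meetRel rP rQ) (Sum.inr (rQ s))) ∧
    (∃ f : BP → MeetBehaviors rP rQ, f ∘ rP = rMeet rP rQ) ∧
    (∃ g : BQ → MeetBehaviors rP rQ, g ∘ rQ = rMeet rP rQ) ∧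
    (∀ (BR : Type u) (rR : BS → BR), Function.Surjective rR →
      (∃ f : BP → BR, f ∘ rP = rR) → (∃ g : BQ → BR, g ∘ rQ = rR) →
      ∃ h : MeetBehaviors rP rQ → BR, h ∘ rMeet rP rQ = rR) := by
  refine ⟨?_, funext (mk_inl_eq_mk_inr rP rQ), ⟨fun a => Quot.mk _ (Sum.inl a), rfl⟩,
    ⟨fun b => Quot.mk _ (Sum.inr b), funext fun s => (mk_inl_eq_mk_inr rP rQ s).symm⟩, ?_⟩
  · rintro ⟨a | b⟩
    · obtain ⟨s, rfl⟩ := hP a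
      exact ⟨s, rfl⟩
    · obtain ⟨s, rfl⟩ := hQ b
      exact ⟨s, mk_inl_eq_mk_inr rP rQ s⟩
  · rintro BR rR - ⟨f, hf⟩ ⟨g, hg⟩
    refine ⟨Quot.lift (Sum.elim f g) ?_, hf⟩
    rintro (a | a) (b | b) hab
    · exact hab.elim
    · obtain ⟨s, rfl, rfl⟩ := hab
      exact (congrFun hf s).trans (congrFun hg s).symm
    · exact hab.elim
    · exact hab.elim
end

section
/- Let S be a system with parts P and Q. If for every constraint ψ : B_Q → Prop we have ◇^Q_P ψ ⊢ □^Q_P ψ, then Q is a part of P, i.e. there exists f : B_P → B_Q with f ∘ r_P = r_Q. -/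
/-- Allowance: `(◇^Q_P ψ) p := ∃ s, r_P s = p ∧ ψ (r_Q s)`. -/
def allows {BS BQ BP : Type*} (rQ : BS → BQ) (rP : BS → BP)
    (ψ : BQ → Prop) : BP → Prop :=
  fun p => ∃ s : BS, rP s = p ∧ ψ (rQ s)

/-- Ensurance: `(□^Q_P ψ) p := ∀ s, r_P s = p → ψ (r_Q s)`. -/
def ensures {BS BQ BP : Type*} (rQ : BS → BQ) (rP : BS → BP)
    (ψ : BQ → Prop) : BP → Prop :=
  fun p => ∀ s : BS, rP s = p → ψ (rQ s)

/-- if `◇^Q_P ψ ⊢ □^Q_P ψ` for every constraint `ψ` on `Q`,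
then `Q` is a part of `P`. -/
theorem allows_entails_ensures_implies_part {BS BP BQ : Type*}
    (rP : BS → BP) (rQ : BS → BQ)
    (hP : Function.Surjective rP) (hQ : Function.Surjective rQ)
    (h : ∀ (ψ : BQ → Prop) (p : BP), allows rQ rP ψ p → ensures rQ rP ψ p) :
    ∃ f : BP → BQ, f ∘ rP = rQ := by
  refine ⟨rQ ∘ Function.surjInv hP, funext fun s => ?_⟩
  exact h (· = rQ s) (rP s) ⟨s, rfl, rfl⟩ _ (Function.surjInv_eq hP (rP s))
end
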